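/- arXiv:math/0308298 — 2 statements merged into one kernel-verified Lean document; each statement's English description precedes it below -/
import Mathlib

section
/- Let (C₀, C₁, s, t, i, ⊙) be an internal category in the category Vect of vector spaces over a field k. Then for every composable pair of arrows f, g ∈ C₁ with t(f) = s(g), the composite is given by the formula ⊙(f,g) = f + g − i(t(f)). In particular, the composition map of an internal category in Vect is uniquely determined by the maps s, t and i: any two internal category structures on the same data (C₀, C₁, s, t, i) have equal composition maps. -/
universe u v

open LinearMap

variable {k : Type u} [Field k]

/-- The space of composable pairs of arrows: pairs `(f, g)` with `t f = s g`; it is a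
submodule of `C₁ × C₁` (the pullback of `t` along `s` in `Vect`). -/
def composablePairs {C₀ C₁ : Type v} [AddCommGroup C₀] [Module k C₀]
    [AddCommGroup C₁] [Module k C₁] (s t : C₁ →ₗ[k] C₀) : Submodule k (C₁ × C₁) :=
  LinearMap.ker (t.comp (LinearMap.fst k C₁ C₁) - s.comp (LinearMap.snd k C₁ C₁))

/-- The composable pair determined by arrows `f, g` with `t f = s g`. -/
def cpair {C₀ C₁ : Type v} [AddCommGroup C₀] [Module k C₀]
    [AddCommGroup C₁] [Module k C₁] (s t : C₁ →ₗ[k] C₀) (f g : C₁) (w : t f = s g) :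
    composablePairs s t :=
  ⟨(f, g), by
    simp only [composablePairs, LinearMap.mem_ker, LinearMap.sub_apply, LinearMap.comp_apply,
      LinearMap.fst_apply, LinearMap.snd_apply, sub_eq_zero, w]⟩

/-- An internal category in the category `Vect` of vector spaces over `k` and linear maps:
vector spaces `C₀` (of objects) and `C₁` (of arrows), linear source and target maps
`s, t : C₁ → C₀`, a linear identity-assigning map `i : C₀ → C₁`, and a linear composition map
`⊙` defined on the pullback `{(f, g) : t f = s g}`, satisfying the usual category axioms. -/
structure VectInternalCat (k : Type u) [Field k] (C₀ C₁ : Type v)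
    [AddCommGroup C₀] [Module k C₀] [AddCommGroup C₁] [Module k C₁] : Type v where
  s : C₁ →ₗ[k] C₀
  t : C₁ →ₗ[k] C₀
  i : C₀ →ₗ[k] C₁
  comp : composablePairs s t →ₗ[k] C₁
  s_i : ∀ x : C₀, s (i x) = x
  t_i : ∀ x : C₀, t (i x) = x
  s_comp : ∀ p : composablePairs s t, s (comp p) = s p.1.1
  t_comp : ∀ p : composablePairs s t, t (comp p) = t p.1.2
  id_comp : ∀ g : C₁, comp (cpair s t (i (s g)) g (t_i (s g))) = g
  comp_id : ∀ f : C₁, comp (cpair s t f (i (t f)) ((s_i (t f)).symm)) = f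
  assoc : ∀ (f g h : C₁) (w₁ : t f = s g) (w₂ : t g = s h),
      comp (cpair s t (comp (cpair s t f g w₁)) h
          (by rw [t_comp (cpair s t f g w₁)]; exact w₂))
        = comp (cpair s t f (comp (cpair s t g h w₂))
          (by rw [s_comp (cpair s t g h w₂)]; exact w₁))

/-- Composition in an internal category in `Vect` is given by `f + g - i (t f)`. -/
theorem VectInternalCat.comp_cpair {k : Type u} [Field k] {C₀ C₁ : Type v}
    [AddCommGroup C₀] [Module k C₀] [AddCommGroup C₁] [Module k C₁]
    (V : VectInternalCat k C₀ C₁) (f g : C₁) (w : V.t f = V.s g) :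
    V.comp (cpair V.s V.t f g w) = f + g - V.i (V.t f) := by
  have key : cpair V.s V.t f g w =
      cpair V.s V.t f (V.i (V.t f)) (V.s_i (V.t f)).symm +
        cpair V.s V.t (V.i (V.s g)) g (V.t_i (V.s g)) -
        cpair V.s V.t (V.i (V.s (V.i (V.t f)))) (V.i (V.t f)) (V.t_i _) := by
    apply Subtype.ext
    simp [cpair, V.s_i, w]
  rw [key, map_sub, map_add, V.comp_id, V.id_comp, V.id_comp]

/-- In an internal category in `Vect`, composition is forced: the composite of a composable
pair `(f, g)` (with `t f = s g`) is `f + g - i (t f)`. In particular the composition map is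
uniquely determined by `s`, `t` and `i`: two internal category structures in `Vect` on the same
data `(C₀, C₁, s, t, i)` are equal (so in particular their composition maps coincide). -/
theorem vectInternalCat_comp_eq_and_unique {k : Type u} [Field k] {C₀ C₁ : Type v}
    [AddCommGroup C₀] [Module k C₀] [AddCommGroup C₁] [Module k C₁]
    (V : VectInternalCat k C₀ C₁) :
    (∀ (f g : C₁) (w : V.t f = V.s g),
        V.comp (cpair V.s V.t f g w) = f + g - V.i (V.t f)) ∧
    (∀ W : VectInternalCat k C₀ C₁, V.s = W.s → V.t = W.t → V.i = W.i → V = W) := by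
  refine ⟨V.comp_cpair, fun W hs ht hi => ?_⟩
  have hV := V.comp_cpair
  have hW := W.comp_cpair
  cases V
  cases W
  dsimp only at hs ht hi hV hW
  subst hs ht hi
  congr 1
  ext ⟨⟨f, g⟩, hp⟩
  have w := sub_eq_zero.mp (LinearMap.mem_ker.mp hp)
  exact (hV f g w).trans (hW f g w).symm
end

section
/- Let V = (V₀, V₁, s, t, i) and W = (W₀, W₁, s', t', i') be 2-vector spaces over a field k. Then the data (V₀ ⊗ W₀, V₁ ⊗ W₁, s ⊗ s', t ⊗ t', i ⊗ i'), with composition given on the pullback {(x,y) ∈ (V₁⊗W₁) × (V₁⊗W₁) : (t⊗t')(x) = (s⊗s')(y)} by x ⊙ y = x + y − (i⊗i')((t⊗t')(x)), is again a 2-vector space (an internal category in Vect); this defines the tensor product V ⊗ W of 2-vector spaces underlying the monoidal structure on 2Vect. -/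
universe u v

open LinearMap

variable {k : Type u} [Field k]

open TensorProduct

/-- A reflexive graph in `Vect` is an internal category under `f ⊙ g = f + g - i (t f)`. -/
def VectInternalCat.ofReflexiveGraph {C₀ C₁ : Type v} [AddCommGroup C₀] [Module k C₀]
    [AddCommGroup C₁] [Module k C₁] (s t : C₁ →ₗ[k] C₀) (i : C₀ →ₗ[k] C₁)
    (s_i : ∀ x, s (i x) = x) (t_i : ∀ x, t (i x) = x) : VectInternalCat k C₀ C₁ where
  s := s
  t := t
  i := i
  comp := (LinearMap.fst k C₁ C₁ + LinearMap.snd k C₁ C₁ -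
    i ∘ₗ t ∘ₗ LinearMap.fst k C₁ C₁) ∘ₗ (composablePairs s t).subtype
  s_i := s_i
  t_i := t_i
  s_comp := by
    rintro ⟨⟨f, g⟩, h⟩
    have w : t f = s g := by simpa [composablePairs, sub_eq_zero] using h
    simp [s_i, w]
  t_comp := by
    rintro ⟨⟨f, g⟩, -⟩
    simp [t_i]
  id_comp g := by simp [cpair, t_i]
  comp_id f := by simp [cpair]
  assoc f g h w₁ w₂ := by
    simp only [cpair, LinearMap.comp_apply, LinearMap.sub_apply, LinearMap.add_apply,
      Submodule.subtype_apply, LinearMap.fst_apply, LinearMap.snd_apply, map_add, map_sub, t_i]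
    abel

/-- The tensor product of 2-vector spaces: for 2-vector spaces `V = (V₀, V₁, s, t, i)` and
`W = (W₀, W₁, s', t', i')` over `k`, the data `(V₀ ⊗ W₀, V₁ ⊗ W₁, s ⊗ s', t ⊗ t', i ⊗ i')`,
with composition `x ⊙ y = x + y - (i ⊗ i') ((t ⊗ t') x)` on the pullback
`{(x, y) : (t ⊗ t') x = (s ⊗ s') y}`, is again a 2-vector space (an internal category in
`Vect`); this is the tensor product underlying the monoidal structure on `2Vect`. -/
theorem vectInternalCat_tensor {k : Type u} [Field k] {V₀ V₁ W₀ W₁ : Type u}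
    [AddCommGroup V₀] [Module k V₀] [AddCommGroup V₁] [Module k V₁]
    [AddCommGroup W₀] [Module k W₀] [AddCommGroup W₁] [Module k W₁]
    (V : VectInternalCat k V₀ V₁) (W : VectInternalCat k W₀ W₁) :
    ∃ T : VectInternalCat k (V₀ ⊗[k] W₀) (V₁ ⊗[k] W₁),
      T.s = TensorProduct.map V.s W.s ∧
      T.t = TensorProduct.map V.t W.t ∧
      T.i = TensorProduct.map V.i W.i ∧
      ∀ (x y : V₁ ⊗[k] W₁) (w : T.t x = T.s y),
        T.comp (cpair T.s T.t x y w)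
          = x + y - TensorProduct.map V.i W.i (TensorProduct.map V.t W.t x) := by
  refine ⟨.ofReflexiveGraph (TensorProduct.map V.s W.s) (TensorProduct.map V.t W.t)
    (TensorProduct.map V.i W.i) (fun x => ?_) (fun x => ?_), rfl, rfl, rfl, fun _ _ _ => rfl⟩
  · have h : V.s ∘ₗ V.i = .id := LinearMap.ext V.s_i
    have h' : W.s ∘ₗ W.i = .id := LinearMap.ext W.s_i
    rw [← LinearMap.comp_apply, ← TensorProduct.map_comp, h, h', TensorProduct.map_id,
      LinearMap.id_apply]
  · have h : V.t ∘ₗ V.i = .id := LinearMap.ext V.t_i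
    have h' : W.t ∘ₗ W.i = .id := LinearMap.ext W.t_i
    rw [← LinearMap.comp_apply, ← TensorProduct.map_comp, h, h', TensorProduct.map_id,
      LinearMap.id_apply]
end
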